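/- The time-dependent Bachelier put pricing function solves the backward heat equation: for every x ∈ ℝ and u ∈ (0,1), ∂p/∂u (x,u) + (1/2)·v(u)·∂²p/∂x² (x,u) = 0. -/

import Mathlib

open MeasureTheory Real Filter

/-- The standard normal density. -/
noncomputable def stdNormalPDF (x : ℝ) : ℝ :=
  (Real.sqrt (2 * Real.pi))⁻¹ * Real.exp (-(x ^ 2) / 2)

/-- The standard normal cumulative distribution function. -/
noncomputable def stdNormalCDF (x : ℝ) : ℝ :=
  ∫ t in Set.Iic x, stdNormalPDF t

theorem continuous_stdNormalPDF : Continuous stdNormalPDF := by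
  unfold stdNormalPDF
  fun_prop

theorem integrable_stdNormalPDF : Integrable stdNormalPDF := by
  have h := (integrable_exp_neg_mul_sq (show (0 : ℝ) < 1 / 2 by norm_num)).const_mul
    (Real.sqrt (2 * Real.pi))⁻¹
  convert h using 3 with x
  unfold stdNormalPDF
  ring_nf

theorem hasDerivAt_stdNormalPDF (x : ℝ) :
    HasDerivAt stdNormalPDF (-x * stdNormalPDF x) x := by
  have h : HasDerivAt (fun y : ℝ => -(y ^ 2) / 2) (-x) x := by
    refine ((hasDerivAt_pow 2 x).fun_neg.div_const 2).congr_deriv ?_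
    norm_num
    ring
  refine (h.exp.const_mul (Real.sqrt (2 * Real.pi))⁻¹).congr_deriv ?_
  unfold stdNormalPDF
  ring

theorem stdNormalCDF_eq_add_intervalIntegral (x : ℝ) :
    stdNormalCDF x = stdNormalCDF 0 + ∫ t in (0 : ℝ)..x, stdNormalPDF t := by
  have h := intervalIntegral.integral_Iic_sub_Iic
    (integrable_stdNormalPDF.integrableOn (s := Set.Iic 0))
    (integrable_stdNormalPDF.integrableOn (s := Set.Iic x))
  unfold stdNormalCDF
  linarith

theorem hasDerivAt_stdNormalCDF (x : ℝ) :
    HasDerivAt stdNormalCDF (stdNormalPDF x) x := by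
  rw [funext stdNormalCDF_eq_add_intervalIntegral]
  exact (continuous_stdNormalPDF.integral_hasStrictDerivAt 0 x).hasDerivAt.const_add _

/-- Chain rule for the Bachelier put price `d Φ(d / s) + s φ(d / s)` with moneyness `d` and
standard deviation `s`: its partial derivatives are `Φ(d / s)` and `φ(d / s)`. -/
theorem HasDerivAt.bachelierPut {d s : ℝ → ℝ} {d' s' t : ℝ}
    (hd : HasDerivAt d d' t) (hs : HasDerivAt s s' t) (hst : s t ≠ 0) :
    HasDerivAt (fun r => d r * stdNormalCDF (d r / s r) + s r * stdNormalPDF (d r / s r))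
      (d' * stdNormalCDF (d t / s t) + s' * stdNormalPDF (d t / s t)) t := by
  have hq := hd.fun_div hs hst
  have h := (hd.fun_mul ((hasDerivAt_stdNormalCDF _).comp t hq)).fun_add
    (hs.fun_mul ((hasDerivAt_stdNormalPDF _).comp t hq))
  refine h.congr_deriv ?_
  simp only [Function.comp_apply]
  field_simp
  ring

/-- The time-dependent Bachelier put pricing function solves the backward heat
equation: for every `x ∈ ℝ` and `u ∈ (0,1)`,
`∂p/∂u (x,u) + (1/2)·v(u)·∂²p/∂x² (x,u) = 0`. -/
theorem bachelier_backward_heat_equation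
    (Δ : ℝ) (v : ℝ → ℝ)
    (hv_cont : ContinuousOn v (Set.Icc 0 1))
    (hv_pos : ∀ t ∈ Set.Icc (0:ℝ) 1, 0 < v t)
    (w : ℝ → ℝ) (hw : ∀ u, w u = ∫ t in (0:ℝ)..u, v t)
    (p : ℝ → ℝ → ℝ)
    (hp : ∀ x : ℝ, ∀ u ∈ Set.Ico (0:ℝ) 1,
      p x u = (Δ - x) * stdNormalCDF ((Δ - x) / Real.sqrt (w 1 - w u))
        + Real.sqrt (w 1 - w u) * stdNormalPDF ((Δ - x) / Real.sqrt (w 1 - w u))) :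
    ∀ x : ℝ, ∀ u ∈ Set.Ioo (0:ℝ) 1,
      deriv (fun s => p x s) u
        + (1 / 2) * v u * deriv (fun y => deriv (fun y' => p y' u) y) x = 0 := by
  intro x u hu
  have hInt : ∀ a ∈ Set.Icc (0 : ℝ) 1, ∀ b ∈ Set.Icc (0 : ℝ) 1,
      IntervalIntegrable v volume a b := fun a ha b hb =>
    (hv_cont.mono (Set.uIcc_subset_Icc ha hb)).intervalIntegrable
  have h0 : (0 : ℝ) ∈ Set.Icc (0 : ℝ) 1 := by simp
  have h1 : (1 : ℝ) ∈ Set.Icc (0 : ℝ) 1 := by simp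
  have hu' : u ∈ Set.Icc (0 : ℝ) 1 := Set.Ioo_subset_Icc_self hu
  have hvar : 0 < w 1 - w u := by
    rw [hw, hw, intervalIntegral.integral_interval_sub_left (hInt 0 h0 1 h1) (hInt 0 h0 u hu')]
    exact intervalIntegral.intervalIntegral_pos_of_pos_on (hInt u hu' 1 h1)
      (fun t ht => hv_pos t ⟨hu.1.le.trans ht.1.le, ht.2.le⟩) hu.2
  have hsd : Real.sqrt (w 1 - w u) ≠ 0 := (Real.sqrt_pos.2 hvar).ne'
  have hw_deriv : HasDerivAt w (v u) u := by
    rw [funext hw]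
    exact intervalIntegral.integral_hasDerivAt_right (hInt 0 h0 u hu')
      ((hv_cont.mono Set.Ioo_subset_Icc_self).stronglyMeasurableAtFilter isOpen_Ioo u hu)
      (hv_cont.continuousAt (Icc_mem_nhds hu.1 hu.2))
  have hsd_deriv : HasDerivAt (fun r => Real.sqrt (w 1 - w r))
      (-v u / (2 * Real.sqrt (w 1 - w u))) u :=
    (hw_deriv.const_sub (w 1)).sqrt hvar.ne'
  have hp_time : HasDerivAt (fun r => p x r)
      (-v u / (2 * Real.sqrt (w 1 - w u))
        * stdNormalPDF ((Δ - x) / Real.sqrt (w 1 - w u))) u := by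
    have h := (hasDerivAt_const u (Δ - x)).bachelierPut hsd_deriv hsd
    rw [zero_mul, zero_add] at h
    refine h.congr_of_eventuallyEq ?_
    filter_upwards [Ioo_mem_nhds hu.1 hu.2] with r hr
    exact hp x r (Set.Ioo_subset_Ico_self hr)
  have hp_space : (fun y => deriv (fun y' => p y' u) y) =
      fun y => -stdNormalCDF ((Δ - y) / Real.sqrt (w 1 - w u)) := by
    funext y
    have h := ((hasDerivAt_id y).const_sub Δ).bachelierPut
      (hasDerivAt_const y (Real.sqrt (w 1 - w u))) hsd
    rw [funext fun y' => hp y' u (Set.Ioo_subset_Ico_self hu)]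
    simpa using h.deriv
  have hp_space_space : HasDerivAt (fun y => -stdNormalCDF ((Δ - y) / Real.sqrt (w 1 - w u)))
      (-(stdNormalPDF ((Δ - x) / Real.sqrt (w 1 - w u)) * (-1 / Real.sqrt (w 1 - w u)))) x :=
    ((hasDerivAt_stdNormalCDF _).comp x
      (((hasDerivAt_id x).const_sub Δ).div_const (Real.sqrt (w 1 - w u)))).neg
  rw [hp_time.deriv, hp_space, hp_space_space.deriv]
  field_simp
  ring
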